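/- The function f : [0,1] → ℝ defined by f(α) = (1 − α)^{3/4} (1 − √(1 − α))^{1/2} is concave on [0,1]. -/

import Mathlib

open Real

noncomputable section

/-- The normalized weighted-perimeter energy of a central disk of mass `α`:
`f(α) = (1 − α)^{3/4}(1 − √(1 − α))^{1/2}`. -/
def diskEnergy (α : ℝ) : ℝ := (1 - α) ^ ((3:ℝ)/4) * (1 - Real.sqrt (1 - α)) ^ ((1:ℝ)/2)

/-- The geometric mean of two nonnegative concave functions is concave. -/
theorem concaveOn_sqrt_mul {s : Set ℝ} {u v : ℝ → ℝ} (hu : ConcaveOn ℝ s u)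
    (hv : ConcaveOn ℝ s v) (hu0 : ∀ x ∈ s, 0 ≤ u x) (hv0 : ∀ x ∈ s, 0 ≤ v x) :
    ConcaveOn ℝ s fun x => √(u x * v x) := by
  refine ⟨hu.1, fun x hx y hy a b ha hb hab => ?_⟩
  have hu' := hu.2 hx hy ha hb hab
  have hv' := hv.2 hx hy ha hb hab
  simp only [smul_eq_mul] at hu' hv' ⊢
  have hux := hu0 x hx
  have huy := hu0 y hy
  have hvx := hv0 x hx
  have hvy := hv0 y hy
  have hmul : (a * u x + b * u y) * (a * v x + b * v y) ≤
      u (a * x + b * y) * v (a * x + b * y) :=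
    mul_le_mul hu' hv' (by positivity) (le_trans (by positivity) hu')
  refine Real.le_sqrt_of_sq_le (le_trans ?_ hmul)
  rw [Real.sqrt_mul hux, Real.sqrt_mul huy]
  have hux2 := Real.sq_sqrt hux
  have huy2 := Real.sq_sqrt huy
  have hvx2 := Real.sq_sqrt hvx
  have hvy2 := Real.sq_sqrt hvy
  generalize √(u x) = p at *
  generalize √(u y) = q at *
  generalize √(v x) = r at *
  generalize √(v y) = t at *
  rw [← hux2, ← huy2, ← hvx2, ← hvy2]
  nlinarith [mul_nonneg (mul_nonneg ha hb) (sq_nonneg (p * t - q * r))]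

theorem diskEnergy_eq_sqrt {α : ℝ} (hα : α ∈ Set.Icc (0 : ℝ) 1) :
    diskEnergy α = √((1 - α) * (√(1 - α) - (1 - α))) := by
  have hx : 0 ≤ 1 - α := sub_nonneg.2 hα.2
  have hpow : (1 - α) ^ ((3 : ℝ) / 4) = √((1 - α) * √(1 - α)) := by
    rw [Real.sqrt_mul hx, Real.sqrt_eq_rpow, Real.sqrt_eq_rpow, ← Real.rpow_mul hx,
      ← Real.rpow_add_of_nonneg hx (by norm_num) (by norm_num)]
    norm_num
  rw [diskEnergy, hpow, ← Real.sqrt_eq_rpow, ← Real.sqrt_mul (by positivity)]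
  congr 1
  linear_combination -(1 - α) * Real.mul_self_sqrt hx

theorem stmt18 : ConcaveOn ℝ (Set.Icc (0:ℝ) 1) diskEnergy := by
  have hlin : ConcaveOn ℝ (Set.Icc (0 : ℝ) 1) fun α => 1 - α :=
    (concaveOn_const 1 (convex_Icc 0 1)).sub (convexOn_id (convex_Icc 0 1))
  have hsqrt : ConcaveOn ℝ (Set.Icc (0 : ℝ) 1) fun α => √(1 - α) - (1 - α) := by
    refine ⟨convex_Icc 0 1, fun x hx y hy a b ha hb hab => ?_⟩
    have h := Real.strictConcaveOn_sqrt.concaveOn.2 (Set.mem_Ici.2 (sub_nonneg.2 hx.2))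
      (Set.mem_Ici.2 (sub_nonneg.2 hy.2)) ha hb hab
    simp only [smul_eq_mul] at h ⊢
    rw [show a * (1 - x) + b * (1 - y) = 1 - (a * x + b * y) by
      linear_combination hab] at h
    linarith
  refine (concaveOn_sqrt_mul hlin hsqrt (fun α hα => sub_nonneg.2 hα.2) fun α hα => ?_).congr
    fun α hα => (diskEnergy_eq_sqrt hα).symm
  have hx : 0 ≤ 1 - α := sub_nonneg.2 hα.2
  exact sub_nonneg.2 (Real.le_sqrt_of_sq_le (by nlinarith [hα.1]))
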